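/- arXiv:1602.02614 — 4 statements merged into one kernel-verified Lean document; each statement's English description precedes it below -/
import Mathlib

section
/- Let (X, d) be a metric space and π a semi-flow on X. Suppose the point p ∈ X is stable P⁺ and its trajectory T(p) = {π(t,p) : t ≥ 0} is contained in a compact subset of X. Let Θ_p denote the closure of T(p). If Θ_p is neither a rest point nor a cycle, then there exists an uncountable set S ⊆ Θ_p such that every point q ∈ S is stable P⁺ and the trajectory T(q) = {π(t,q) : t ≥ 0} is dense in Θ_p. -/
open Filter Topology

section Semiflow

variable {X : Type*} {π : ℝ → X → X}

/-- A residual subset of a nonempty T1 Baire space is uncountable, provided none of its points is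
isolated. -/
theorem not_countable_of_mem_residual {Y : Type*} [TopologicalSpace Y] [T1Space Y] [BaireSpace Y]
    [Nonempty Y] {G : Set Y} (hG : G ∈ residual Y) (hiso : ∀ x ∈ G, ¬ IsOpen ({x} : Set Y)) :
    ¬ G.Countable := by
  intro hc
  have h : (⋂ x ∈ G, ({x}ᶜ : Set Y)) ∈ residual Y :=
    (countable_bInter_mem hc).2 fun x hx => residual_of_dense_open isOpen_compl_singleton
      (dense_compl_singleton_iff_not_open.2 (hiso x hx))
  obtain ⟨x, hxG, hx⟩ := (dense_of_mem_residual (inter_mem hG h)).nonempty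
  simp only [Set.mem_iInter] at hx
  exact hx x hxG rfl

theorem mapClusterPt_atTop_iff_dist [MetricSpace X] {u : ℝ → X} {y : X} :
    MapClusterPt y atTop u ↔ ∀ k n : ℕ, ∃ t : ℝ, (n : ℝ) ≤ t ∧ dist (u t) y < 1 / ((k : ℝ) + 1) := by
  rw [Metric.nhds_basis_ball_inv_nat_succ.mapClusterPt_iff_frequently]
  simp only [Metric.mem_ball, forall_const, frequently_atTop]
  refine ⟨fun h k n => h k n, fun h k a => ?_⟩
  obtain ⟨n, hn⟩ := exists_nat_ge a
  obtain ⟨t, ht, h'⟩ := h k n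
  exact ⟨t, hn.trans ht, h'⟩

theorem MapClusterPt.exists_seq_atTop [MetricSpace X] {u : ℝ → X} {y : X} (h : MapClusterPt y atTop u) :
    ∃ t : ℕ → ℝ, Tendsto t atTop atTop ∧ Tendsto (fun n => u (t n)) atTop (𝓝 y) := by
  choose t ht hd using fun n : ℕ => mapClusterPt_atTop_iff_dist.1 h n n
  refine ⟨t, tendsto_atTop_mono ht tendsto_natCast_atTop_atTop, ?_⟩
  exact tendsto_iff_dist_tendsto_zero.2 (squeeze_zero (fun _ => dist_nonneg) (fun n => (hd n).le)
    tendsto_one_div_add_atTop_nhds_zero_nat)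

/-- The orbit of a periodic point of a semi-flow is the image of one period. -/
theorem orbit_eq_image_Icc_of_periodic
    (hπadd : ∀ t₁ t₂ : ℝ, 0 ≤ t₁ → 0 ≤ t₂ → ∀ p : X, π t₁ (π t₂ p) = π (t₁ + t₂) p)
    {q : X} {T : ℝ} (hT : 0 < T) (hq : π T q = q) :
    {x : X | ∃ t : ℝ, 0 ≤ t ∧ π t q = x} = (fun t => π t q) '' Set.Icc 0 T := by
  have hper : ∀ (n : ℕ) (s : ℝ), 0 ≤ s → π (s + n * T) q = π s q := by
    intro n
    induction n with
    | zero => simp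
    | succ n ih =>
      intro s hs
      have : s + ((n + 1 : ℕ) : ℝ) * T = (s + n * T) + T := by push_cast; ring
      rw [this, ← hπadd _ _ (by positivity) hT.le, hq, ih s hs]
  ext x
  constructor
  · rintro ⟨t, ht, rfl⟩
    have hfl := Nat.floor_le (div_nonneg ht hT.le)
    have hlt := Nat.lt_floor_add_one (t / T)
    rw [le_div_iff₀ hT] at hfl
    rw [div_lt_iff₀ hT] at hlt
    refine ⟨t - ⌊t / T⌋₊ * T, ⟨by linarith, by linarith⟩, ?_⟩
    have := hper ⌊t / T⌋₊ (t - ⌊t / T⌋₊ * T) (by linarith)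
    rw [sub_add_cancel] at this
    exact this.symm
  · rintro ⟨t, ht, rfl⟩
    exact ⟨t, ht.1, rfl⟩

end Semiflow

/-- If `p` is positively Poisson stable, its trajectory lies in a compact set,
and the closure `Θ_p` of the trajectory is neither a rest point nor a cycle, then `Θ_p`
contains an uncountable set of points, each positively Poisson stable, whose trajectories
are dense in `Θ_p`. -/
theorem unpredictable_stmt0 {X : Type*} [MetricSpace X] (π : ℝ → X → X)
    (hπ0 : ∀ p : X, π 0 p = p)
    (hπcont : ContinuousOn (fun q : ℝ × X => π q.1 q.2) (Set.Ici (0 : ℝ) ×ˢ Set.univ))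
    (hπadd : ∀ t₁ t₂ : ℝ, 0 ≤ t₁ → 0 ≤ t₂ → ∀ p : X, π t₁ (π t₂ p) = π (t₁ + t₂) p)
    (p : X)
    (hPoisson : ∃ t : ℕ → ℝ, Tendsto t atTop atTop ∧
      Tendsto (fun n => π (t n) p) atTop (𝓝 p))
    (hcompact : ∃ C : Set X, IsCompact C ∧ {x : X | ∃ t : ℝ, 0 ≤ t ∧ π t p = x} ⊆ C)
    (hnotrest : ¬ ∃ q : X, closure {x : X | ∃ t : ℝ, 0 ≤ t ∧ π t p = x} = {q} ∧
      (∀ t : ℝ, 0 ≤ t → π t q = q))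
    (hnotcycle : ¬ ∃ q : X, (∃ T : ℝ, 0 < T ∧ π T q = q) ∧
      closure {x : X | ∃ t : ℝ, 0 ≤ t ∧ π t p = x} = {x : X | ∃ t : ℝ, 0 ≤ t ∧ π t q = x}) :
    ∃ S : Set X, S ⊆ closure {x : X | ∃ t : ℝ, 0 ≤ t ∧ π t p = x} ∧ ¬ S.Countable ∧
      ∀ q ∈ S,
        (∃ t : ℕ → ℝ, Tendsto t atTop atTop ∧
          Tendsto (fun n => π (t n) q) atTop (𝓝 q)) ∧
        closure {x : X | ∃ t : ℝ, 0 ≤ t ∧ π t p = x} ⊆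
          closure {x : X | ∃ t : ℝ, 0 ≤ t ∧ π t q = x} := by
  set K : Set X := closure {x : X | ∃ t : ℝ, 0 ≤ t ∧ π t p = x} with hK
  have hcont_pt : ∀ t : ℝ, 0 ≤ t → Continuous (π t) := fun t ht =>
    hπcont.comp_continuous (f := fun x : X => (t, x)) (by fun_prop) fun x => ⟨ht, trivial⟩
  have hcont_time : ∀ q : X, ContinuousOn (fun t => π t q) (Set.Ici 0) := fun q =>
    hπcont.comp (f := fun t : ℝ => (t, q)) (by fun_prop) fun t ht => ⟨ht, trivial⟩
  obtain ⟨C, hC, hpC⟩ := hcompact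
  have hKc : IsCompact K := hC.closure_of_subset hpC
  have hpK : ∀ s : ℝ, 0 ≤ s → π s p ∈ K := fun s hs => subset_closure ⟨s, hs, rfl⟩
  have hKinv : ∀ t : ℝ, 0 ≤ t → ∀ x ∈ K, π t x ∈ K := by
    intro t ht
    refine (Set.MapsTo.closure (f := π t) ?_ (hcont_pt t ht) : Set.MapsTo (π t) K K)
    rintro _ ⟨s, hs, rfl⟩
    exact ⟨t + s, by positivity, (hπadd t s ht hs p).symm⟩
  have homega : ∀ s : ℝ, 0 ≤ s → ∀ y ∈ K, MapClusterPt y atTop (fun t => π t (π s p)) := by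
    intro s hs
    refine closure_minimal ?_ isClosed_setOfPred_clusterPt
    rintro _ ⟨r, hr, rfl⟩
    obtain ⟨t, ht, htp⟩ := hPoisson
    have hlim : Tendsto (fun n => π r (π (t n) p)) atTop (𝓝 (π r p)) :=
      ((hcont_pt r hr).tendsto p).comp htp
    have htop : Tendsto (fun n => r + t n - s) atTop atTop := by
      simpa only [add_sub_right_comm] using tendsto_atTop_add_const_left _ (r - s) ht
    refine MapClusterPt.of_comp htop (Tendsto.mapClusterPt (hlim.congr' ?_))
    filter_upwards [htop.eventually_ge_atTop 0, ht.eventually_ge_atTop 0] with n hn hn'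
    simp only [Function.comp_apply]
    rw [hπadd _ _ hr hn', hπadd _ _ hn hs, sub_add_cancel]
  have hKne : Nonempty K := ⟨⟨π 0 p, hpK 0 le_rfl⟩⟩
  have : CompactSpace K := isCompact_iff_compactSpace.1 hKc
  let G : Set K := {x | ∀ y ∈ K, MapClusterPt y atTop (fun t => π t x)}
  have hG : G ∈ residual K := by
    obtain ⟨D, hDc, hDd⟩ := TopologicalSpace.exists_countable_dense K
    let O : K → ℕ → ℕ → Set K := fun d k n =>
      ⋃ t : {t : ℝ // (n : ℝ) ≤ t}, {x : K | dist (π t x) d < 1 / ((k : ℝ) + 1)}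
    have hO : ∀ d k n, O d k n ∈ residual K := by
      intro d k n
      refine residual_of_dense_open (isOpen_iUnion fun t => ?_) ?_
      · have := (hcont_pt t (n.cast_nonneg.trans t.2)).comp (continuous_subtype_val (p := (· ∈ K)))
        exact isOpen_lt (this.dist continuous_const) continuous_const
      · intro x
        rw [closure_subtype]
        refine closure_mono ?_ x.2
        rintro _ ⟨s, hs, rfl⟩
        obtain ⟨t, ht, htd⟩ := mapClusterPt_atTop_iff_dist.1 (homega s hs d d.2) k n
        exact ⟨⟨π s p, hpK s hs⟩, Set.mem_iUnion.2 ⟨⟨t, ht⟩, htd⟩, rfl⟩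
    have hI : (⋂ d ∈ D, ⋂ k, ⋂ n, O d k n) ∈ residual K :=
      (countable_bInter_mem hDc).2 fun d _ =>
        countable_iInter_mem.2 fun k => countable_iInter_mem.2 fun n => hO d k n
    refine mem_of_superset hI fun x hx y hy => ?_
    simp only [Set.mem_iInter, O, Set.mem_iUnion, Set.mem_ofPred_eq] at hx
    have hclosed : IsClosed {z : K | MapClusterPt (z : X) atTop (fun t => π t x)} :=
      isClosed_setOfPred_clusterPt.preimage continuous_subtype_val
    refine closure_minimal (fun d hd => ?_) hclosed (hDd ⟨y, hy⟩)
    refine mapClusterPt_atTop_iff_dist.2 fun k n => ?_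
    obtain ⟨t, ht⟩ := hx d hd k n
    exact ⟨t, t.2, ht⟩
  have hdense : ∀ x ∈ G, K ⊆ closure {y : X | ∃ t : ℝ, 0 ≤ t ∧ π t x = y} := by
    intro x hx y hy
    obtain ⟨t, ht, hty⟩ := (hx y hy).exists_seq_atTop
    refine mem_closure_of_tendsto hty ?_
    filter_upwards [ht.eventually_ge_atTop 0] with n hn using ⟨t n, hn, rfl⟩
  have hiso : ∀ x ∈ G, ¬ IsOpen ({x} : Set K) := by
    intro x hx hopen
    obtain ⟨U, hU, hUx⟩ := isOpen_induced_iff.1 hopen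
    have hxU : (x : X) ∈ U := (Set.ext_iff.1 hUx x).2 rfl
    obtain ⟨T, hTU, hT⟩ := (((hx x x.2).frequently (hU.mem_nhds hxU)).and_eventually
      (eventually_gt_atTop 0)).exists
    have hTx : π T x = x :=
      congrArg Subtype.val ((Set.ext_iff.1 hUx ⟨π T x, hKinv T hT.le x x.2⟩).1 hTU)
    refine hnotcycle ⟨x, ⟨T, hT, hTx⟩, Set.Subset.antisymm ?_ ?_⟩
    · have hcl : IsClosed {y : X | ∃ t : ℝ, 0 ≤ t ∧ π t x = y} := by
        rw [orbit_eq_image_Icc_of_periodic hπadd hT hTx]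
        exact (isCompact_Icc.image_of_continuousOn
          ((hcont_time x).mono Set.Icc_subset_Ici_self)).isClosed
      exact (hdense x hx).trans hcl.closure_subset
    · rintro _ ⟨t, ht, rfl⟩
      exact hKinv t ht x x.2
  refine ⟨Subtype.val '' G, Subtype.coe_image_subset K G, fun h => ?_, ?_⟩
  · exact not_countable_of_mem_residual hG hiso
      (Set.countable_of_injective_of_countable_image Subtype.val_injective.injOn h)
  · rintro _ ⟨x, hx, rfl⟩
    exact ⟨(hx x x.2).exists_seq_atTop, hdense x hx⟩
end

section
/- Let (X, d) be a metric space and π a semi-flow on X. If p ∈ X is an unpredictable point, then the dynamics on Θ_p, the closure of the trajectory T(p) = {π(t,p) : t ≥ 0}, is sensitive: there exists ε₀ > 0 such that for every u ∈ Θ_p and every δ > 0 there exist a point u_δ ∈ Θ_p and a number τ_δ > 0 with d(u_δ, u) < δ and d(π(τ_δ, u_δ), π(τ_δ, u)) ≥ ε₀. -/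
open Filter Topology

/-- If `p` is an unpredictable point of a semi-flow `π`, then the dynamics
on `Θ_p`, the closure of the trajectory of `p`, is sensitive. -/
theorem unpredictable_stmt1 {X : Type*} [MetricSpace X] (π : ℝ → X → X)
    (hπ0 : ∀ p : X, π 0 p = p)
    (hπcont : ContinuousOn (fun q : ℝ × X => π q.1 q.2) (Set.Ici (0 : ℝ) ×ˢ Set.univ))
    (hπadd : ∀ t₁ t₂ : ℝ, 0 ≤ t₁ → 0 ≤ t₂ → ∀ p : X, π t₁ (π t₂ p) = π (t₁ + t₂) p)
    (p : X)
    (hunpred : ∃ ε₀ : ℝ, 0 < ε₀ ∧ ∃ t τ : ℕ → ℝ,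
      Tendsto t atTop atTop ∧ Tendsto τ atTop atTop ∧
      Tendsto (fun n => π (t n) p) atTop (𝓝 p) ∧
      ∀ n : ℕ, dist (π (t n + τ n) p) (π (τ n) p) ≥ ε₀) :
    ∃ ε₀ : ℝ, 0 < ε₀ ∧
      ∀ u ∈ closure {x : X | ∃ t : ℝ, 0 ≤ t ∧ π t p = x}, ∀ δ : ℝ, 0 < δ →
        ∃ v ∈ closure {x : X | ∃ t : ℝ, 0 ≤ t ∧ π t p = x}, ∃ τ : ℝ, 0 < τ ∧
          dist v u < δ ∧ dist (π τ v) (π τ u) ≥ ε₀ := by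
  obtain ⟨ε, hε, t, τ, ht, hτ, hp, hsep⟩ := hunpred
  refine ⟨ε / 2, half_pos hε, fun u hu δ hδ => ?_⟩
  obtain ⟨_, ⟨s, hs, rfl⟩, hus⟩ := Metric.mem_closure_iff.1 hu δ hδ
  have hcont : Continuous (π s) := by
    rw [← continuousOn_univ]
    exact hπcont.comp (f := fun x : X => (s, x)) (by fun_prop) fun x _ => ⟨hs, trivial⟩
  have hlim : Tendsto (fun n => π s (π (t n) p)) atTop (𝓝 (π s p)) :=
    (hcont.tendsto p).comp hp
  have hnear : ∀ᶠ n in atTop, dist (π s (π (t n) p)) u < δ :=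
    (hlim.dist tendsto_const_nhds).eventually_lt_const (by rwa [dist_comm])
  obtain ⟨n, hn, htn, hτn⟩ :=
    (hnear.and ((ht.eventually_ge_atTop 0).and (hτ.eventually_gt_atTop s))).exists
  have hpos : 0 < τ n - s := sub_pos.2 hτn
  have hw : π (τ n - s) (π s p) = π (τ n) p := by
    rw [hπadd _ _ hpos.le hs, sub_add_cancel]
  have hv : π (τ n - s) (π s (π (t n) p)) = π (t n + τ n) p := by
    rw [hπadd _ _ hpos.le hs, sub_add_cancel, hπadd _ _ (hs.trans hτn.le) htn, add_comm]
  by_cases h : dist (π (τ n - s) (π s p)) (π (τ n - s) u) ≥ ε / 2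
  · exact ⟨π s p, subset_closure ⟨s, hs, rfl⟩, τ n - s, hpos, by rwa [dist_comm], h⟩
  · refine ⟨π s (π (t n) p), subset_closure ⟨s + t n, add_nonneg hs htn, ?_⟩,
      τ n - s, hpos, hn, ?_⟩
    · rw [hπadd _ _ hs htn]
    · rw [hw] at h
      rw [hv]
      linarith [hsep n, dist_triangle_right (π (t n + τ n) p) (π (τ n) p) (π (τ n - s) u)]
end

section
/- Let (X, d) be a metric space and π a semi-flow on X. If p ∈ X is an unpredictable point, then p is not periodic and not a rest point: for every t > 0 one has π(t, p) ≠ p. Consequently, the trajectory T(p) = {π(t,p) : t ≥ 0} is neither a rest point nor a cycle. -/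
open Filter Topology

/-- Along points fixed at time `T > 0`, any time may be reduced into `[0, T]`. -/
theorem exists_reduced_time {X : Type*} (π : ℝ → X → X)
    (hπ0 : ∀ p : X, π 0 p = p)
    (hπadd : ∀ t₁ t₂ : ℝ, 0 ≤ t₁ → 0 ≤ t₂ → ∀ p : X, π t₁ (π t₂ p) = π (t₁ + t₂) p)
    {T : ℝ} (hT : 0 < T) {u : ℝ} (hu : 0 ≤ u) :
    ∃ s ∈ Set.Icc 0 T, ∀ x, π T x = x → π u x = π s x := by
  have hmul : ∀ x, π T x = x → ∀ n : ℕ, π (n * T) x = x := by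
    intro x hx n
    induction n with
    | zero => simpa using hπ0 x
    | succ k ih =>
      rw [Nat.cast_succ, add_mul, one_mul, ← hπadd _ _ (by positivity) hT.le, hx, ih]
  have hle : (⌊u / T⌋₊ : ℝ) * T ≤ u := (le_div_iff₀ hT).1 (Nat.floor_le (by positivity))
  have hlt : u < (⌊u / T⌋₊ + 1 : ℝ) * T := (div_lt_iff₀ hT).1 (Nat.lt_floor_add_one _)
  refine ⟨u - ⌊u / T⌋₊ * T, ⟨by linarith, by linarith⟩, fun x hx => ?_⟩
  conv_rhs => rw [← hmul x hx ⌊u / T⌋₊]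
  rw [hπadd _ _ (by linarith) (by positivity), sub_add_cancel]

/-- The orbit of an unpredictable point never returns to that point. -/
theorem ne_self_of_unpredictable {X : Type*} [MetricSpace X] (π : ℝ → X → X)
    (hπ0 : ∀ p : X, π 0 p = p)
    (hπcont : ContinuousOn (fun q : ℝ × X => π q.1 q.2) (Set.Ici (0 : ℝ) ×ˢ Set.univ))
    (hπadd : ∀ t₁ t₂ : ℝ, 0 ≤ t₁ → 0 ≤ t₂ → ∀ p : X, π t₁ (π t₂ p) = π (t₁ + t₂) p)
    (p : X) {ε₀ : ℝ} (hε : 0 < ε₀) {t τ : ℕ → ℝ}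
    (ht : Tendsto t atTop atTop) (hτ : Tendsto τ atTop atTop)
    (hp : Tendsto (fun n => π (t n) p) atTop (𝓝 p))
    (hsep : ∀ n : ℕ, dist (π (t n + τ n) p) (π (τ n) p) ≥ ε₀) (T : ℝ) (hT : 0 < T) :
    π T p ≠ p := by
  intro hper
  have hred : ∀ n, ∃ s ∈ Set.Icc 0 T, 0 ≤ τ n → ∀ x, π T x = x → π (τ n) x = π s x := by
    intro n
    by_cases hn : 0 ≤ τ n
    · obtain ⟨s, hs, h⟩ := exists_reduced_time π hπ0 hπadd hT hn
      exact ⟨s, hs, fun _ => h⟩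
    · exact ⟨0, ⟨le_rfl, hT.le⟩, fun h => absurd h hn⟩
  choose s hs hsx using hred
  obtain ⟨a, ha, φ, hφ, hlim⟩ := isCompact_Icc.tendsto_subseq hs
  have hconv : ∀ x : ℕ → X, Tendsto x atTop (𝓝 p) →
      Tendsto (fun n => π (s (φ n)) (x n)) atTop (𝓝 (π a p)) := fun x hx =>
    (hπcont (a, p) ⟨ha.1, trivial⟩).tendsto.comp
      (tendsto_nhdsWithin_iff.2 ⟨hlim.prodMk_nhds hx,
        Eventually.of_forall fun n => ⟨(hs (φ n)).1, trivial⟩⟩)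
  have hdist := (hconv _ (hp.comp hφ.tendsto_atTop)).dist (hconv _ tendsto_const_nhds)
  rw [dist_self] at hdist
  have hφ' := hφ.tendsto_atTop
  obtain ⟨n, hn, htn, hτn⟩ := ((hdist.eventually (gt_mem_nhds hε)).and
    (((ht.comp hφ').eventually_ge_atTop 0).and ((hτ.comp hφ').eventually_ge_atTop 0))).exists
  simp only [Function.comp_apply] at hn htn hτn
  have horbit : π T (π (t (φ n)) p) = π (t (φ n)) p := by
    rw [hπadd _ _ hT.le htn, add_comm, ← hπadd _ _ htn hT.le, hper]
  rw [← hsx _ hτn _ horbit, ← hsx _ hτn _ hper, hπadd _ _ hτn htn, add_comm] at hn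
  exact absurd hn (hsep (φ n)).not_gt

/-- If `p` is an unpredictable point of a semi-flow `π`, then `π t p ≠ p`
for every `t > 0`; consequently the trajectory of `p` is neither a rest point nor a cycle. -/
theorem unpredictable_stmt2 {X : Type*} [MetricSpace X] (π : ℝ → X → X)
    (hπ0 : ∀ p : X, π 0 p = p)
    (hπcont : ContinuousOn (fun q : ℝ × X => π q.1 q.2) (Set.Ici (0 : ℝ) ×ˢ Set.univ))
    (hπadd : ∀ t₁ t₂ : ℝ, 0 ≤ t₁ → 0 ≤ t₂ → ∀ p : X, π t₁ (π t₂ p) = π (t₁ + t₂) p)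
    (p : X)
    (hunpred : ∃ ε₀ : ℝ, 0 < ε₀ ∧ ∃ t τ : ℕ → ℝ,
      Tendsto t atTop atTop ∧ Tendsto τ atTop atTop ∧
      Tendsto (fun n => π (t n) p) atTop (𝓝 p) ∧
      ∀ n : ℕ, dist (π (t n + τ n) p) (π (τ n) p) ≥ ε₀) :
    (∀ t : ℝ, 0 < t → π t p ≠ p) ∧
    (¬ ∃ q : X, (∀ t : ℝ, 0 ≤ t → π t q = q) ∧
      {x : X | ∃ t : ℝ, 0 ≤ t ∧ π t p = x} = {q}) ∧
    (¬ ∃ q : X, (∃ T : ℝ, 0 < T ∧ π T q = q) ∧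
      {x : X | ∃ t : ℝ, 0 ≤ t ∧ π t p = x} = {x : X | ∃ t : ℝ, 0 ≤ t ∧ π t q = x}) := by
  obtain ⟨ε₀, hε, t, τ, ht, hτ, hp, hsep⟩ := hunpred
  have hne := ne_self_of_unpredictable π hπ0 hπcont hπadd p hε ht hτ hp hsep
  have hmem : p ∈ {x : X | ∃ t : ℝ, 0 ≤ t ∧ π t p = x} := ⟨0, le_rfl, hπ0 p⟩
  refine ⟨hne, ?_, ?_⟩
  · rintro ⟨q, hq, horb⟩
    rw [horb, Set.mem_singleton_iff] at hmem
    exact hne 1 one_pos (hmem ▸ hq 1 zero_le_one)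
  · rintro ⟨q, ⟨T, hT, hq⟩, horb⟩
    rw [horb] at hmem
    obtain ⟨r, hr, rfl⟩ := hmem
    apply hne T hT
    rw [hπadd _ _ hT.le hr, add_comm, ← hπadd _ _ hr hT.le, hq]
end

section
/- Let (X, d) be a metric space and π a semi-flow on X. If p ∈ X is an unpredictable point with sensitivity constant ε₀, then every point of the trajectory T(p) is also unpredictable with the same sensitivity constant ε₀: for every s ≥ 0, the point π(s, p) is unpredictable with sensitivity constant ε₀. -/
open Filter Topology

/-- If `p` is an unpredictable point with sensitivity constant `ε₀`, then
every point `π s p` of the trajectory of `p` is unpredictable with the same constant `ε₀`. -/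
theorem unpredictable_stmt3 {X : Type*} [MetricSpace X] (π : ℝ → X → X)
    (hπ0 : ∀ p : X, π 0 p = p)
    (hπcont : ContinuousOn (fun q : ℝ × X => π q.1 q.2) (Set.Ici (0 : ℝ) ×ˢ Set.univ))
    (hπadd : ∀ t₁ t₂ : ℝ, 0 ≤ t₁ → 0 ≤ t₂ → ∀ p : X, π t₁ (π t₂ p) = π (t₁ + t₂) p)
    (p : X) (ε₀ : ℝ) (hε₀ : 0 < ε₀)
    (hunpred : ∃ t τ : ℕ → ℝ,
      Tendsto t atTop atTop ∧ Tendsto τ atTop atTop ∧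
      Tendsto (fun n => π (t n) p) atTop (𝓝 p) ∧
      ∀ n : ℕ, dist (π (t n + τ n) p) (π (τ n) p) ≥ ε₀) :
    ∀ s : ℝ, 0 ≤ s → ∃ t τ : ℕ → ℝ,
      Tendsto t atTop atTop ∧ Tendsto τ atTop atTop ∧
      Tendsto (fun n => π (t n) (π s p)) atTop (𝓝 (π s p)) ∧
      ∀ n : ℕ, dist (π (t n + τ n) (π s p)) (π (τ n) (π s p)) ≥ ε₀ := by
  intro s hs
  obtain ⟨t, τ, ht, hτ, hlim, hsep⟩ := hunpred
  have hcont : Continuous (π s) :=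
    hπcont.comp_continuous (f := fun q : X => (s, q)) (by fun_prop) fun _ => ⟨hs, trivial⟩
  obtain ⟨N, hN⟩ := eventually_atTop.1
    ((ht.eventually_ge_atTop 0).and (hτ.eventually_ge_atTop s))
  have hshift : Tendsto (fun n : ℕ => n + N) atTop atTop := tendsto_add_atTop_nat N
  refine ⟨fun n => t (n + N), fun n => τ (n + N) - s, ht.comp hshift,
    tendsto_atTop_add_const_right _ (-s) (hτ.comp hshift), ?_, fun n => ?_⟩
  · refine ((hcont.tendsto p).comp (hlim.comp hshift)).congr fun n => ?_
    have h0 := (hN (n + N) (Nat.le_add_left N n)).1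
    simp only [Function.comp_apply]
    rw [hπadd _ _ hs h0, hπadd _ _ h0 hs, add_comm]
  · obtain ⟨h0, h1⟩ := hN (n + N) (Nat.le_add_left N n)
    rw [hπadd _ _ (by linarith) hs, hπadd _ _ (by linarith) hs, ← add_sub_assoc,
      sub_add_cancel, sub_add_cancel]
    exact hsep (n + N)
end
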